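/- arXiv:2305.08007 — 2 statements merged into one kernel-verified Lean document; each statement's English description precedes it below -/
import Mathlib

section
/- Let G = ⟨B, h, s | [h,a]=[h,b]=[h,c]=1, (h²)^s = ha⟩ where B = ⟨a,b,c | a²=1, [a,a^b]=1, [b,c]=1, a^c = a·a^b⟩, and let H = ⟨h²⟩ ≤ G. Then the conjugation orbit Orb_G(H) = {gHg⁻¹ : g ∈ G} has no isolated points in Sub(G). -/
open Filter

/-- Relators of `G = ⟨a,b,c,h,s ∣ a²=1, [a,a^b]=1, [b,c]=1, a^c=a·a^b,
[h,a]=[h,b]=[h,c]=1, (h²)^s = ha⟩`; generators `0 ↦ a`, `1 ↦ b`, `2 ↦ c`, `3 ↦ h`,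
`4 ↦ s`. -/
def Grels : Set (FreeGroup (Fin 5)) :=
  let a := FreeGroup.of (0 : Fin 5)
  let b := FreeGroup.of (1 : Fin 5)
  let c := FreeGroup.of (2 : Fin 5)
  let h := FreeGroup.of (3 : Fin 5)
  let s := FreeGroup.of (4 : Fin 5)
  { a ^ 2,
    a⁻¹ * (b⁻¹ * a * b)⁻¹ * a * (b⁻¹ * a * b),
    b⁻¹ * c⁻¹ * b * c,
    (c⁻¹ * a * c)⁻¹ * (a * (b⁻¹ * a * b)),
    h⁻¹ * a⁻¹ * h * a,
    h⁻¹ * b⁻¹ * h * b,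
    h⁻¹ * c⁻¹ * h * c,
    (s⁻¹ * h ^ 2 * s) * (h * a)⁻¹ }

/-- The group `G = ⟨B, h, s ∣ [h,a]=[h,b]=[h,c]=1, (h²)^s = ha⟩`. -/
def OGroup := PresentedGroup Grels

instance : Group OGroup := by unfold OGroup; infer_instance

/-- The topology on `Sub(G)` induced from the product topology on `2^G = (G → Prop)`
with `Prop` discrete. -/
def subgroupSpaceTopology (G : Type*) [Group G] : TopologicalSpace (Subgroup G) :=
  TopologicalSpace.induced (fun H : Subgroup G => fun g : G => g ∈ H)
    (@Pi.topologicalSpace G (fun _ => Prop) (fun _ => ⊥))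


namespace OrbProof

abbrev KK := RatFunc (ZMod 2)

noncomputable def mulP (x : KK) (hx : x ≠ 0) : Equiv.Perm KK where
  toFun y := x * y
  invFun y := x⁻¹ * y
  left_inv y := by field_simp
  right_inv y := by field_simp

noncomputable def addP : Equiv.Perm KK where
  toFun y := y + 1
  invFun y := y - 1
  left_inv y := by ring
  right_inv y := by ring

lemma X_ne : (RatFunc.X : KK) ≠ 0 := RatFunc.X_ne_zero

lemma X_one_ne : (1 + RatFunc.X : KK) ≠ 0 := by
  have h : (1 + RatFunc.X : KK) = algebraMap (Polynomial (ZMod 2)) KK (Polynomial.X + Polynomial.C 1) := by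
    simp [add_comm]
  rw [h]
  intro h0
  rw [← map_zero (algebraMap (Polynomial (ZMod 2)) KK)] at h0
  exact Polynomial.X_add_C_ne_zero (1 : ZMod 2) (RatFunc.algebraMap_injective (ZMod 2) h0)

lemma two_eq : (1 : KK) + 1 = 0 := by
  have h : ((1 : ZMod 2) + 1) = 0 := by decide
  have := congrArg (algebraMap (ZMod 2) KK) h
  simpa using this

abbrev PP := Multiplicative ℤ × Equiv.Perm KK

noncomputable def pa : PP := (1, addP)
noncomputable def pb : PP := (1, (mulP RatFunc.X X_ne)⁻¹)
noncomputable def pc : PP := (1, (mulP (1 + RatFunc.X) X_one_ne)⁻¹)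
def ph : PP := (Multiplicative.ofAdd 1, 1)

lemma addP_apply (y : KK) : addP y = y + 1 := rfl
lemma addP_inv_apply (y : KK) : addP⁻¹ y = y - 1 := rfl
lemma mulP_apply (x : KK) (hx) (y : KK) : mulP x hx y = x * y := rfl
lemma mulP_inv_apply (x : KK) (hx) (y : KK) : (mulP x hx)⁻¹ y = x⁻¹ * y := rfl

lemma addP_symm_apply (y : KK) : Equiv.symm addP y = y - 1 := rfl
lemma mulP_symm_apply (x : KK) (hx) (y : KK) : Equiv.symm (mulP x hx) y = x⁻¹ * y := rfl

lemma inj_of_fst (u : PP) (h : u.1 ≠ 1) : Function.Injective (zpowersHom PP u) := by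
  rw [injective_iff_map_eq_one]
  intro n hn
  have h1 : u.1 ^ (Multiplicative.toAdd n) = 1 := congrArg Prod.fst hn
  have h2 := congrArg Multiplicative.toAdd h1
  rw [toAdd_zpow, toAdd_one, smul_eq_mul] at h2
  rcases mul_eq_zero.1 h2 with h2 | h2
  · exact h2
  · exact absurd h2 h

lemma inj1 : Function.Injective (zpowersHom PP (ph ^ 2)) :=
  inj_of_fst _ (by simp only [ph]; decide)

lemma inj2 : Function.Injective (zpowersHom PP (ph * pa)) :=
  inj_of_fst _ (by simp [ph, pa])

noncomputable def phi : (zpowersHom PP (ph ^ 2)).range ≃* (zpowersHom PP (ph * pa)).range :=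
  (MonoidHom.ofInjective inj1).symm.trans (MonoidHom.ofInjective inj2)

abbrev TT := HNNExtension PP _ _ phi

noncomputable def incl : PP →* TT := HNNExtension.of

lemma conj_rel : (HNNExtension.t : TT) * incl (ph ^ 2) = incl (ph * pa) * HNNExtension.t := by
  have h := HNNExtension.t_mul_of (φ := phi)
    (MonoidHom.ofInjective inj1 (Multiplicative.ofAdd 1))
  have e1 : ((MonoidHom.ofInjective inj1 (Multiplicative.ofAdd 1) : _) : PP) = ph ^ 2 := by
    rw [MonoidHom.ofInjective_apply]; simp
  have e2 : ((phi (MonoidHom.ofInjective inj1 (Multiplicative.ofAdd 1)) : _) : PP) = ph * pa := by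
    rw [phi, MulEquiv.trans_apply, MulEquiv.symm_apply_apply, MonoidHom.ofInjective_apply]; simp
  rw [e1, e2] at h
  exact h

noncomputable def gens : Fin 5 → TT :=
  ![incl pa, incl pb, incl pc, incl ph, HNNExtension.t⁻¹]

lemma rel1 : pa ^ 2 = 1 := by
  ext y
  · simp [pa]
  · simp only [pa, sq, Prod.mk_mul_mk, Equiv.Perm.mul_apply, addP_apply, Prod.snd_one,
      Equiv.Perm.one_apply, add_assoc, two_eq, add_zero]

lemma rel2 : pa⁻¹ * (pb⁻¹ * pa * pb)⁻¹ * pa * (pb⁻¹ * pa * pb) = 1 := by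
  have hX := X_ne
  ext y
  · simp [pa, pb]
  · simp [pa, pb, mul_assoc]
    simp only [addP_apply, addP_symm_apply, mulP_apply, mulP_symm_apply]
    field_simp
    ring

lemma rel3 : pb⁻¹ * pc⁻¹ * pb * pc = 1 := by
  have hX := X_ne
  have hX1 := X_one_ne
  ext y
  · simp [pc, pb]
  · simp [pc, pb, mul_assoc]
    simp only [mulP_apply, mulP_symm_apply]
    field_simp

lemma rel4 : (pc⁻¹ * pa * pc)⁻¹ * (pa * (pb⁻¹ * pa * pb)) = 1 := by
  rw [inv_mul_eq_one]
  have hX := X_ne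
  have hX1 := X_one_ne
  ext y
  · simp [pa, pc, pb]
  · simp [pa, pc, pb, mul_assoc]
    simp only [addP_apply, mulP_apply, mulP_symm_apply]
    field_simp
    ring

lemma ph_comm (p : Equiv.Perm KK) : ph⁻¹ * (1, p)⁻¹ * ph * (1, p) = 1 := by
  ext <;> simp [ph]

lemma gens_rel : ∀ r ∈ Grels, FreeGroup.lift gens r = 1 := by
  intro r hr
  simp only [Grels, Set.mem_insert_iff, Set.mem_singleton_iff] at hr
  have e0 : gens 0 = incl pa := rfl
  have e1 : gens 1 = incl pb := rfl
  have e2 : gens 2 = incl pc := rfl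
  have e3 : gens 3 = incl ph := rfl
  have e4 : gens 4 = HNNExtension.t⁻¹ := rfl
  rcases hr with rfl | rfl | rfl | rfl | rfl | rfl | rfl | rfl <;>
    simp only [map_mul, map_inv, map_pow, FreeGroup.lift_apply_of, e0, e1, e2, e3, e4]
  · rw [← map_pow, rel1, map_one]
  · simp only [← map_mul, ← map_inv, rel2, map_one]
  · simp only [← map_mul, ← map_inv, rel3, map_one]
  · simp only [← map_mul, ← map_inv, rel4, map_one]
  · simp only [← map_mul, ← map_inv, pa, ph_comm, map_one]
  · simp only [← map_mul, ← map_inv, pb, ph_comm, map_one]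
  · simp only [← map_mul, ← map_inv, pc, ph_comm, map_one]
  · rw [mul_inv_eq_one, inv_inv, ← map_pow, conj_rel, mul_inv_cancel_right]
    exact map_mul incl ph pa

noncomputable def toT : OGroup →* TT := PresentedGroup.toGroup gens_rel

def gen (i : Fin 5) : OGroup := PresentedGroup.of i

lemma toT_gen (i : Fin 5) : toT (gen i) = gens i := PresentedGroup.toGroup.of gens_rel

lemma rel_eq (r : FreeGroup (Fin 5)) (hr : r ∈ Grels) :
    FreeGroup.lift gen r = 1 := by
  have h : (PresentedGroup.mk Grels) r = 1 := PresentedGroup.one_of_mem hr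
  have e : (FreeGroup.lift gen : FreeGroup (Fin 5) →* OGroup) = PresentedGroup.mk Grels := by
    ext i; simp only [FreeGroup.lift_apply_of]; rfl
  rw [e]; exact h

lemma a_sq : gen 0 ^ 2 = 1 := by
  have := rel_eq (FreeGroup.of 0 ^ 2) (by simp [Grels])
  simpa only [map_pow, FreeGroup.lift_apply_of] using this

lemma h_a : gen 3 * gen 0 = gen 0 * gen 3 := by
  have := rel_eq ((FreeGroup.of 3)⁻¹ * (FreeGroup.of 0)⁻¹ * FreeGroup.of 3 * FreeGroup.of 0)
    (by simp [Grels])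
  simp only [map_mul, map_inv, FreeGroup.lift_apply_of] at this
  rw [mul_assoc, ← mul_inv_rev, inv_mul_eq_one] at this
  exact this.symm

lemma h_b : gen 3 * gen 1 = gen 1 * gen 3 := by
  have := rel_eq ((FreeGroup.of 3)⁻¹ * (FreeGroup.of 1)⁻¹ * FreeGroup.of 3 * FreeGroup.of 1)
    (by simp [Grels])
  simp only [map_mul, map_inv, FreeGroup.lift_apply_of] at this
  rw [mul_assoc, ← mul_inv_rev, inv_mul_eq_one] at this
  exact this.symm

lemma h_s : (gen 4)⁻¹ * gen 3 ^ 2 * gen 4 = gen 3 * gen 0 := by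
  have := rel_eq (((FreeGroup.of 4)⁻¹ * FreeGroup.of 3 ^ 2 * FreeGroup.of 4) *
      (FreeGroup.of 3 * FreeGroup.of 0)⁻¹) (by simp [Grels])
  simp only [map_mul, map_inv, map_pow, FreeGroup.lift_apply_of] at this
  rwa [mul_inv_eq_one] at this

def an (n : ℕ) : OGroup := (gen 1 ^ n)⁻¹ * gen 0 * gen 1 ^ n

lemma an_sq (n : ℕ) : an n ^ 2 = 1 := by
  have h := a_sq
  rw [sq] at h ⊢
  have : an n * an n = (gen 1 ^ n)⁻¹ * (gen 0 * gen 0) * gen 1 ^ n := by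
    simp only [an]; group
  rw [this, h]; group

lemma h_an (n : ℕ) : Commute (gen 3) (an n) := by
  have hb : Commute (gen 3) (gen 1) := h_b
  have ha : Commute (gen 3) (gen 0) := h_a
  exact ((hb.pow_right n).inv_right.mul_right ha).mul_right (hb.pow_right n)

lemma incl_inj : Function.Injective incl := HNNExtension.of_injective phi

lemma h_inf (k : ℤ) (h : gen 3 ^ k = 1) : k = 0 := by
  have h1 := congrArg toT h
  rw [map_zpow, toT_gen, map_one] at h1
  have h2 : incl (ph ^ k) = incl 1 := by rw [map_zpow, map_one]; exact h1
  have h3 := congrArg Prod.fst (incl_inj h2)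
  have h4 := congrArg Multiplicative.toAdd h3
  simpa [ph] using h4

lemma h_inj {k l : ℤ} (h : gen 3 ^ k = gen 3 ^ l) : k = l := by
  have := h_inf (k - l) (by rw [zpow_sub, h, mul_inv_cancel])
  omega

lemma mulP_pow (x : KK) (hx) (n : ℕ) (y : KK) : (mulP x hx ^ n) y = x ^ n * y := by
  induction n generalizing y with
  | zero => simp
  | succ n ih => rw [pow_succ, Equiv.Perm.mul_apply, ih, mulP_apply]; ring

lemma mulP_inv_pow (x : KK) (hx) (n : ℕ) : ((mulP x hx)⁻¹ ^ n) 0 = 0 := by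
  induction n with
  | zero => simp
  | succ n ih => rw [pow_succ, Equiv.Perm.mul_apply, mulP_inv_apply, mul_zero, ih]

lemma an_inj : Function.Injective an := by
  intro m n h
  have key : ∀ n, toT (an n) = incl ((pb ^ n)⁻¹ * pa * pb ^ n) := by
    intro n
    simp only [an, map_mul, map_inv, map_pow, toT_gen]
    rfl
  have key2 : ∀ n : ℕ, ((pb ^ n)⁻¹ * pa * pb ^ n).2 0 = (RatFunc.X : KK) ^ n := by
    intro n
    have : ((pb ^ n)⁻¹ * pa * pb ^ n).2 =
        (mulP RatFunc.X X_ne) ^ n * (addP * (mulP RatFunc.X X_ne)⁻¹ ^ n) := by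
      simp [pb, pa, mul_assoc]
    rw [this, Equiv.Perm.mul_apply, Equiv.Perm.mul_apply, mulP_inv_pow, addP_apply, mulP_pow]
    ring
  have h1 := congrArg toT h
  rw [key, key] at h1
  have h2 := incl_inj h1
  have h3 : (RatFunc.X : KK) ^ m = RatFunc.X ^ n := by rw [← key2, ← key2, h2]
  rw [← RatFunc.algebraMap_X, ← map_pow, ← map_pow] at h3
  have h4 := RatFunc.algebraMap_injective (ZMod 2) h3
  have := congrArg Polynomial.natDegree h4
  simpa using this

/-- the approximating subgroups at `H` -/
def LL (n : ℕ) : Subgroup OGroup := Subgroup.zpowers (gen 3 * an n)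

lemma LL_sq (n : ℕ) : (gen 3 * an n) ^ (2 : ℤ) = gen 3 ^ (2 : ℤ) := by
  rw [(h_an n).mul_zpow]
  have := an_sq n
  rw [zpow_ofNat, zpow_ofNat, this, mul_one]

lemma LL_even (n : ℕ) (k : ℤ) : (gen 3 * an n) ^ (2 * k) = gen 3 ^ (2 * k) := by
  rw [zpow_mul, LL_sq, ← zpow_mul]

lemma LL_odd (n : ℕ) (k : ℤ) : (gen 3 * an n) ^ (2 * k + 1) = gen 3 ^ (2 * k + 1) * an n := by
  rw [zpow_add, LL_even, zpow_one, zpow_add, zpow_one, mul_assoc]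

lemma odd_inj {m n : ℕ} {k l : ℤ}
    (h : gen 3 ^ (2 * k + 1) * an m = gen 3 ^ (2 * l + 1) * an n) : m = n := by
  have h2 : (gen 3 ^ (2 * k + 1) * an m) ^ 2 = (gen 3 ^ (2 * l + 1) * an n) ^ 2 := by rw [h]
  rw [((h_an m).zpow_left _).mul_pow, ((h_an n).zpow_left _).mul_pow, an_sq, an_sq, mul_one,
    mul_one, ← zpow_natCast, ← zpow_natCast, ← zpow_mul, ← zpow_mul] at h2
  have h3 := h_inj h2
  have h4 : k = l := by push_cast at h3; omega
  subst h4
  exact an_inj (mul_left_cancel h)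

def HH : Subgroup OGroup := Subgroup.zpowers (gen 3 ^ 2)

lemma mem_HH (x : OGroup) : x ∈ HH ↔ ∃ k : ℤ, gen 3 ^ (2 * k) = x := by
  simp only [HH, Subgroup.mem_zpowers_iff, zpow_mul]
  rfl

lemma HH_le (n : ℕ) : HH ≤ LL n := by
  intro x hx
  obtain ⟨k, rfl⟩ := (mem_HH x).1 hx
  exact ⟨2 * k, LL_even n k⟩

lemma odd_not_mem (n : ℕ) : gen 3 * an n ∉ HH := by
  intro hx
  obtain ⟨k, hk⟩ := (mem_HH _).1 hx
  have h2 : (gen 3 ^ (2 * k)) ^ (2 : ℤ) = (gen 3 * an n) ^ (2 : ℤ) := by rw [hk]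
  rw [LL_sq, ← zpow_mul] at h2
  have := h_inj h2
  omega

lemma LL_ev (x : OGroup) : ∀ᶠ n in atTop, (x ∈ LL n ↔ x ∈ HH) := by
  by_cases hx : ∃ (m : ℕ) (k : ℤ), x = gen 3 ^ (2 * k + 1) * an m
  · obtain ⟨m, k, rfl⟩ := hx
    filter_upwards [eventually_gt_atTop m] with n hn
    refine ⟨?_, fun h => HH_le n h⟩
    rintro ⟨l, hl⟩
    rcases Int.even_or_odd' l with ⟨j, rfl | rfl⟩
    · rw [mem_HH]
      exact ⟨j, by rw [← LL_even n]; exact hl⟩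
    · have h1 : gen 3 ^ (2 * j + 1) * an n = gen 3 ^ (2 * k + 1) * an m := by
        rw [← LL_odd]; exact hl
      have := odd_inj h1
      omega
  · refine Eventually.of_forall fun n => ⟨?_, fun h => HH_le n h⟩
    rintro ⟨l, hl⟩
    rcases Int.even_or_odd' l with ⟨j, rfl | rfl⟩
    · rw [mem_HH]
      exact ⟨j, by rw [← LL_even n]; exact hl⟩
    · exact absurd ⟨n, j, by rw [← LL_odd]; exact hl.symm⟩ hx

lemma LL_eq (n : ℕ) :
    LL n = Subgroup.map (MulAut.conj ((gen 1 ^ n)⁻¹ * (gen 4)⁻¹)).toMonoidHom HH := by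
  rw [HH, MonoidHom.map_zpowers, LL]
  congr 1
  have hb : Commute (gen 3) (gen 1) := h_b
  have h1 := (hb.pow_right n).inv_right
  simp only [MulEquiv.coe_toMonoidHom, MulAut.conj_apply]
  have : (gen 1 ^ n)⁻¹ * (gen 4)⁻¹ * gen 3 ^ 2 * ((gen 1 ^ n)⁻¹ * (gen 4)⁻¹)⁻¹ =
      (gen 1 ^ n)⁻¹ * ((gen 4)⁻¹ * gen 3 ^ 2 * gen 4) * gen 1 ^ n := by group
  rw [this, h_s, an, ← mul_assoc, ← mul_assoc, ← mul_assoc, h1.eq]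

lemma mem_conj (g x : OGroup) (L : Subgroup OGroup) :
    x ∈ Subgroup.map (MulAut.conj g).toMonoidHom L ↔ g⁻¹ * x * g ∈ L := by
  constructor
  · rintro ⟨y, hy, rfl⟩
    have : g⁻¹ * (g * y * g⁻¹) * g = y := by group
    simpa [this] using hy
  · intro h
    exact ⟨_, h, by simp [MulAut.conj_apply]; group⟩

end OrbProof

open OrbProof
/-- With `H = ⟨h²⟩ ≤ G`, the conjugation orbit `Orb_G(H)` has no isolated points in
`Sub(G)`. -/
theorem orbit_h_sq_no_isolated_points :
    letI := subgroupSpaceTopology OGroup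
    ∀ K ∈ {K : Subgroup OGroup | ∃ g : OGroup,
        K = Subgroup.map (MulAut.conj g).toMonoidHom
          (Subgroup.zpowers ((PresentedGroup.of 3 : OGroup) ^ 2))},
      AccPt K (𝓟 {K : Subgroup OGroup | ∃ g : OGroup,
        K = Subgroup.map (MulAut.conj g).toMonoidHom
          (Subgroup.zpowers ((PresentedGroup.of 3 : OGroup) ^ 2))}) := by
  letI := subgroupSpaceTopology OGroup
  change ∀ K ∈ {K : Subgroup OGroup | ∃ g : OGroup,
        K = Subgroup.map (MulAut.conj g).toMonoidHom HH},
      AccPt K (𝓟 {K : Subgroup OGroup | ∃ g : OGroup,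
        K = Subgroup.map (MulAut.conj g).toMonoidHom HH})
  rintro K ⟨g, rfl⟩
  have hT : Tendsto (fun n => Subgroup.map (MulAut.conj g).toMonoidHom (LL n)) atTop
      (nhds (Subgroup.map (MulAut.conj g).toMonoidHom HH)) := by
    letI : TopologicalSpace Prop := ⊥
    haveI : DiscreteTopology Prop := ⟨rfl⟩
    change Tendsto _ atTop (@nhds _ (TopologicalSpace.induced
      (fun H : Subgroup OGroup => fun g : OGroup => g ∈ H) Pi.topologicalSpace) _)
    rw [nhds_induced, tendsto_comap_iff, tendsto_pi_nhds]
    intro x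
    rw [nhds_discrete, tendsto_pure]
    filter_upwards [LL_ev (g⁻¹ * x * g)] with n hn
    simp only [Function.comp_apply, mem_conj]
    exact propext hn
  rw [accPt_iff_frequently]
  refine hT.frequently (Eventually.frequently (Eventually.of_forall fun n => ⟨?_, ?_⟩))
  · intro h
    have h1 := Subgroup.map_injective (MulAut.conj g).injective h
    exact odd_not_mem n (h1 ▸ Subgroup.mem_zpowers (gen 3 * an n))
  · refine ⟨g * ((gen 1 ^ n)⁻¹ * (gen 4)⁻¹), ?_⟩
    rw [LL_eq, Subgroup.map_map, map_mul MulAut.conj g]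
    rfl
end

section
/- Let G be a finitely generated group with generating tuple (a₁,…,a_n). The map f: Sub(G) → 𝒢_{n+1} sending a subgroup H to the marked group (E(G,H), (a₁,…,a_n,t)), where E(G,H) = ⟨G, t | h^t = h, h ∈ H⟩, is injective and continuous; moreover f sends conjugate subgroups of G to isomorphic marked groups. -/
/-- The map `Sub(G) → 𝒢_{n+1}`, `H ↦ (E(G,H), (a₁,…,a_n,t))`, where a marked
`(n+1)`-generated group is identified with the kernel of the corresponding marking
homomorphism `F_{n+1} → E(G,H)` (sending the first `n` generators to `a₁,…,a_n` and the
last one to the stable letter `t`). -/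
def markedHNN {G : Type*} [Group G] {n : ℕ} (a : Fin n → G) (H : Subgroup G) :
    Subgroup (FreeGroup (Fin (n + 1))) :=
  MonoidHom.ker (FreeGroup.lift (fun i : Fin (n + 1) =>
    Fin.lastCases (motive := fun _ => HNNExtension G H H (MulEquiv.refl H))
      (HNNExtension.t (G := G) (A := H) (B := H) (φ := MulEquiv.refl H))
      (fun j => HNNExtension.of (a j)) i))

instance {G : Type*} [Group G] {n : ℕ} (a : Fin n → G) (H : Subgroup G) :
    (markedHNN a H).Normal := by
  unfold markedHNN; infer_instance

open HNNExtension HNNExtension.NormalWord Topology Filter in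
theorem HNN_comm_iff {G : Type*} [Group G] (H : Subgroup G) (g : G) :
    (t * of g : HNNExtension G H H (MulEquiv.refl H)) = of g * t ↔ g ∈ H := by
  constructor
  · intro h
    let w₁ : ReducedWord G H H := ⟨1, [(1, g)], by simp⟩
    let w₂ : ReducedWord G H H := ⟨g, [(1, 1)], by simp⟩
    have := (ReducedWord.map_fst_eq_and_of_prod_eq (MulEquiv.refl H) (w₁ := w₁) (w₂ := w₂)
      (by simpa [w₁, w₂, ReducedWord.prod] using h)).2 1 (by simp [w₁])
    simpa [w₁, w₂] using this
  · intro h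
    exact t_mul_of (φ := MulEquiv.refl H) ⟨g, h⟩

/-- The marking homomorphism. -/
def markHom {G : Type*} [Group G] {n : ℕ} (a : Fin n → G) (H : Subgroup G) :
    FreeGroup (Fin (n + 1)) →* HNNExtension G H H (MulEquiv.refl H) :=
  FreeGroup.lift (fun i : Fin (n + 1) =>
    Fin.lastCases (motive := fun _ => HNNExtension G H H (MulEquiv.refl H))
      (HNNExtension.t (G := G) (A := H) (B := H) (φ := MulEquiv.refl H))
      (fun j => HNNExtension.of (a j)) i)

theorem mem_markedHNN {G : Type*} [Group G] {n : ℕ} (a : Fin n → G) (H : Subgroup G)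
    (w : FreeGroup (Fin (n + 1))) : w ∈ markedHNN a H ↔ markHom a H w = 1 := Iff.rfl

theorem markHom_last {G : Type*} [Group G] {n : ℕ} (a : Fin n → G) (H : Subgroup G) :
    markHom a H (FreeGroup.of (Fin.last n)) = HNNExtension.t := by
  simp [markHom]

theorem markHom_castSucc {G : Type*} [Group G] {n : ℕ} (a : Fin n → G) (H : Subgroup G)
    (j : Fin n) :
    markHom a H (FreeGroup.of j.castSucc) = HNNExtension.of (a j) := by
  simp [markHom]

theorem exists_word {G : Type*} [Group G] {n : ℕ} (a : Fin n → G)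
    (hgen : Subgroup.closure (Set.range a) = ⊤) (g : G) :
    ∃ w : FreeGroup (Fin (n + 1)), ∀ H : Subgroup G, markHom a H w = HNNExtension.of g := by
  have hg : g ∈ Subgroup.closure (Set.range a) := hgen ▸ Subgroup.mem_top g
  induction hg using Subgroup.closure_induction with
  | mem x hx =>
    obtain ⟨j, rfl⟩ := hx
    exact ⟨_, fun H => markHom_castSucc a H j⟩
  | one => exact ⟨1, by simp⟩
  | mul x y _ _ hx hy =>
    obtain ⟨u, hu⟩ := hx
    obtain ⟨v, hv⟩ := hy
    exact ⟨u * v, fun H => by simp [hu, hv]⟩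
  | inv x _ hx =>
    obtain ⟨u, hu⟩ := hx
    exact ⟨u⁻¹, fun H => by simp [hu]⟩

theorem markHom_surjective {G : Type*} [Group G] {n : ℕ} (a : Fin n → G)
    (hgen : Subgroup.closure (Set.range a) = ⊤) (H : Subgroup G) :
    Function.Surjective (markHom a H) := by
  intro x
  induction x using HNNExtension.induction_on with
  | of g => exact (exists_word a hgen g).imp fun w hw => hw H
  | t => exact ⟨_, markHom_last a H⟩
  | mul x y hx hy =>
    obtain ⟨u, rfl⟩ := hx
    obtain ⟨v, rfl⟩ := hy
    exact ⟨u * v, map_mul _ _ _⟩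
  | inv x hx =>
    obtain ⟨u, rfl⟩ := hx
    exact ⟨u⁻¹, map_inv _ _⟩

theorem markedHNN_injective {G : Type*} [Group G] {n : ℕ} (a : Fin n → G)
    (hgen : Subgroup.closure (Set.range a) = ⊤) : Function.Injective (markedHNN a) := by
  intro H K h
  ext g
  obtain ⟨w, hw⟩ := exists_word a hgen g
  have key : ∀ L : Subgroup G, g ∈ L ↔ (FreeGroup.of (Fin.last n) * w) *
      (w * FreeGroup.of (Fin.last n))⁻¹ ∈ markedHNN a L := by
    intro L
    rw [mem_markedHNN, map_mul, map_inv, mul_inv_eq_one, map_mul, map_mul, hw, markHom_last,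
      HNN_comm_iff]
  rw [key, key, h]

/-- Conjugate subgroups give isomorphic HNN extensions. -/
theorem HNN_conj {G : Type*} [Group G] (H K : Subgroup G) (g : G)
    (hK : K = Subgroup.map (MulAut.conj g).toMonoidHom H) :
    Nonempty (HNNExtension G H H (MulEquiv.refl H) ≃*
      HNNExtension G K K (MulEquiv.refl K)) := by
  have h1 : ∀ x : H, (HNNExtension.t * HNNExtension.of (MulAut.conj g (x : G)) :
      HNNExtension G K K (MulEquiv.refl K)) = HNNExtension.of (MulAut.conj g (x : G)) *
        HNNExtension.t := by
    intro x
    rw [HNN_comm_iff, hK]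
    exact ⟨x, x.2, rfl⟩
  have h2 : ∀ x : K, (HNNExtension.t * HNNExtension.of ((MulAut.conj g).symm (x : G)) :
      HNNExtension G H H (MulEquiv.refl H)) = HNNExtension.of ((MulAut.conj g).symm (x : G)) *
        HNNExtension.t := by
    rintro ⟨x, hx⟩
    rw [HNN_comm_iff]
    rw [hK] at hx
    obtain ⟨y, hy, rfl⟩ := hx
    simpa [mul_assoc] using hy
  refine ⟨MonoidHom.toMulEquiv
    (HNNExtension.lift (HNNExtension.of.comp (MulAut.conj g).toMonoidHom) HNNExtension.t h1)
    (HNNExtension.lift (HNNExtension.of.comp (MulAut.conj g).symm.toMonoidHom)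
      HNNExtension.t h2) ?_ ?_⟩
  · refine HNNExtension.hom_ext ?_ ?_
    · ext x
      simp only [MonoidHom.comp_apply, HNNExtension.lift_of, MulEquiv.toMonoidHom_eq_coe, MonoidHom.coe_coe, MulEquiv.symm_apply_apply, MonoidHom.id_apply]
    · rw [MonoidHom.comp_apply]
      refine Eq.trans (congrArg _ (HNNExtension.lift_t _ _ h1)) (HNNExtension.lift_t _ _ h2)
  · refine HNNExtension.hom_ext ?_ ?_
    · ext x
      simp only [MonoidHom.comp_apply, HNNExtension.lift_of, MulEquiv.toMonoidHom_eq_coe, MonoidHom.coe_coe, MulEquiv.apply_symm_apply, MonoidHom.id_apply]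
    · rw [MonoidHom.comp_apply]
      refine Eq.trans (congrArg _ (HNNExtension.lift_t _ _ h2)) (HNNExtension.lift_t _ _ h1)

open HNNExtension HNNExtension.NormalWord Filter in
theorem exists_uniform_reducedWord {G : Type*} [Group G] {n : ℕ} (a : Fin n → G)
    (H : Subgroup G) (l : Filter (Subgroup G)) (hl : ∀ g : G, ∀ᶠ K in l, (g ∈ K ↔ g ∈ H))
    (w : FreeGroup (Fin (n + 1))) :
    ∃ (g : G) (L : List (ℤˣ × G)), ∀ᶠ K in l, ∃ r : ReducedWord G K K,
      r.head = g ∧ r.toList = L ∧ r.prod (MulEquiv.refl K) = markHom a K w := by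
  -- multiplication by an element of `G`
  have hG : ∀ (v w : FreeGroup (Fin (n + 1))) (x : G), (∀ K, markHom a K v = of x) →
      (∃ (g : G) (L : List (ℤˣ × G)), ∀ᶠ K in l, ∃ r : ReducedWord G K K,
        r.head = g ∧ r.toList = L ∧ r.prod (MulEquiv.refl K) = markHom a K w) →
      (∃ (g : G) (L : List (ℤˣ × G)), ∀ᶠ K in l, ∃ r : ReducedWord G K K,
        r.head = g ∧ r.toList = L ∧ r.prod (MulEquiv.refl K) = markHom a K (v * w)) := by
    rintro v w x hv ⟨g, L, h⟩
    refine ⟨x * g, L, h.mono ?_⟩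
    rintro K ⟨r, rfl, rfl, hr⟩
    refine ⟨⟨x * r.head, r.toList, r.chain⟩, rfl, rfl, ?_⟩
    rw [map_mul, hv, ← hr]
    simp [ReducedWord.prod, mul_assoc]
  have hT : ∀ (v w : FreeGroup (Fin (n + 1))) (u : ℤˣ),
      (∀ K, markHom a K v = t ^ (u : ℤ)) →
      (∃ (g : G) (L : List (ℤˣ × G)), ∀ᶠ K in l, ∃ r : ReducedWord G K K,
        r.head = g ∧ r.toList = L ∧ r.prod (MulEquiv.refl K) = markHom a K w) →
      (∃ (g : G) (L : List (ℤˣ × G)), ∀ᶠ K in l, ∃ r : ReducedWord G K K,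
        r.head = g ∧ r.toList = L ∧ r.prod (MulEquiv.refl K) = markHom a K (v * w)) := by
    rintro v w u hv ⟨g, L, h⟩
    have hsub : ∀ K : Subgroup G, toSubgroup K K u = K := fun K => by simp [toSubgroup]
    by_cases hc : g ∈ H ∧ ∃ g' L', L = (-u, g') :: L'
    · obtain ⟨hg, g', L', rfl⟩ := hc
      refine ⟨g * g', L', ?_⟩
      filter_upwards [h, hl g]
      rintro K ⟨r, rfl, hL, hr⟩ hgK
      have hch := r.chain
      rw [hL] at hch
      refine ⟨⟨r.head * g', L', (List.isChain_cons.1 hch).2⟩, rfl, rfl, ?_⟩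
      have hcomm : Commute (t : HNNExtension G K K (MulEquiv.refl K)) (of r.head) :=
        (HNN_comm_iff K r.head).2 (hgK.2 hg)
      have hc2 := (hcomm.zpow_left (u : ℤ)).eq
      rw [map_mul, hv, ← hr]
      simp only [ReducedWord.prod, hL, List.map_cons, List.prod_cons, map_mul, Units.val_neg]
      rw [← mul_assoc (t ^ (u : ℤ)), hc2]
      simp [mul_assoc]
    · refine ⟨1, (u, g) :: L, ?_⟩
      filter_upwards [h, hl g]
      rintro K ⟨r, rfl, rfl, hr⟩ hgK
      refine ⟨⟨1, (u, r.head) :: r.toList, ?_⟩, rfl, rfl, ?_⟩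
      · rw [List.isChain_cons]
        refine ⟨?_, r.chain⟩
        rintro ⟨u', g'⟩ hy hmem
        simp only [hsub] at hmem
        by_contra hne
        apply hc
        refine ⟨hgK.1 hmem, g', r.toList.tail, ?_⟩
        have : u' = -u := by
          have := Int.units_ne_iff_eq_neg.1 (Ne.symm hne)
          exact this
        subst this
        exact (List.cons_head?_tail hy).symm
      · rw [map_mul, hv, ← hr]
        simp [ReducedWord.prod, mul_assoc]
  suffices hv : ∀ v w : FreeGroup (Fin (n + 1)),
      (∃ (g : G) (L : List (ℤˣ × G)), ∀ᶠ K in l, ∃ r : ReducedWord G K K,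
        r.head = g ∧ r.toList = L ∧ r.prod (MulEquiv.refl K) = markHom a K w) →
      (∃ (g : G) (L : List (ℤˣ × G)), ∀ᶠ K in l, ∃ r : ReducedWord G K K,
        r.head = g ∧ r.toList = L ∧ r.prod (MulEquiv.refl K) = markHom a K (v * w)) by
    have := hv w 1 ⟨1, [], Eventually.of_forall fun K =>
      ⟨⟨1, [], by simp⟩, rfl, rfl, by simp [ReducedWord.prod]⟩⟩
    rwa [mul_one] at this
  intro v
  induction v using FreeGroup.induction_on with
  | C1 => intro w hw; rwa [one_mul]
  | of i =>
    intro w ih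
    induction i using Fin.lastCases with
    | last => exact hT _ w 1 (fun K => by simp [markHom_last]) ih
    | cast j => exact hG _ w (a j) (fun K => markHom_castSucc a K j) ih
  | inv_of i _ =>
    intro w ih
    induction i using Fin.lastCases with
    | last => exact hT _ w (-1) (fun K => by simp [markHom_last]) ih
    | cast j => exact hG _ w (a j)⁻¹ (fun K => by rw [map_inv, markHom_castSucc, map_inv]) ih
  | mul x y hx hy =>
    intro w ih
    rw [mul_assoc]
    exact hx _ (hy _ ih)

open HNNExtension HNNExtension.NormalWord in
theorem prod_eq_one_iff {G : Type*} [Group G] (K : Subgroup G) (r : ReducedWord G K K) :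
    r.prod (MulEquiv.refl K) = 1 ↔ r.head = 1 ∧ r.toList = [] := by
  constructor
  · intro h
    have h2 := ReducedWord.toList_eq_nil_of_mem_of_range (MulEquiv.refl K) r
      (h ▸ one_mem _)
    refine ⟨?_, h2⟩
    apply of_injective (φ := MulEquiv.refl K)
    simpa [ReducedWord.prod, h2] using h
  · rintro ⟨h1, h2⟩
    simp [ReducedWord.prod, h1, h2]

open Filter Topology in
theorem markedHNN_continuous {G : Type*} [Group G] {n : ℕ} (a : Fin n → G) :
    @Continuous _ _ (subgroupSpaceTopology G)
      (subgroupSpaceTopology (FreeGroup (Fin (n + 1)))) (markedHNN a) := by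
  letI := subgroupSpaceTopology G
  have hev : ∀ (H : Subgroup G) (g : G), ∀ᶠ K in 𝓝 H, (g ∈ K ↔ g ∈ H) := by
    intro H g
    letI : TopologicalSpace Prop := ⊥
    haveI : DiscreteTopology Prop := ⟨rfl⟩
    have hc : Continuous (fun H : Subgroup G => fun g : G => g ∈ H) := continuous_induced_dom
    have hc2 : Continuous (fun H : Subgroup G => g ∈ H) := (continuous_apply g).comp hc
    have := (continuous_iff_continuousAt.1 hc2 H).eventually
      (show ∀ᶠ p in 𝓝 (g ∈ H), p = (g ∈ H) by rw [nhds_discrete]; rfl)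
    exact this.mono fun K hK => by rw [hK]
  letI : TopologicalSpace Prop := ⊥
  haveI : DiscreteTopology Prop := ⟨rfl⟩
  refine continuous_induced_rng.2 (continuous_pi fun w => ?_)
  rw [continuous_iff_continuousAt]
  intro H
  obtain ⟨g, L, h⟩ := exists_uniform_reducedWord a H (𝓝 H) (hev H) w
  have hK : ∀ᶠ K in 𝓝 H, (w ∈ markedHNN a K) = (g = 1 ∧ L = []) := by
    refine h.mono ?_
    rintro K ⟨r, rfl, rfl, hr⟩
    rw [mem_markedHNN, ← hr, prod_eq_one_iff]
  have hH := hK.self_of_nhds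
  refine continuousAt_const.congr (f := fun _ => (g = 1 ∧ L = [])) ?_
  exact hK.mono fun K h => h.symm

/-- For a group `G` generated by `(a₁,…,a_n)`, the map `f : Sub(G) → 𝒢_{n+1}`,
`H ↦ (E(G,H), (a₁,…,a_n,t))`, is injective and continuous, lands in the space of marked
groups (i.e. each `f(H)` is a normal subgroup of `F_{n+1}`), and sends conjugate
subgroups of `G` to isomorphic marked groups. -/
theorem marked_embedding (G : Type*) [Group G] (n : ℕ) (a : Fin n → G)
    (hgen : Subgroup.closure (Set.range a) = ⊤) :
    Function.Injective (markedHNN a) ∧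
    @Continuous _ _ (subgroupSpaceTopology G)
      (subgroupSpaceTopology (FreeGroup (Fin (n + 1)))) (markedHNN a) ∧
    (∀ H : Subgroup G, (markedHNN a H).Normal) ∧
    ∀ (H : Subgroup G) (g : G),
      Nonempty ((FreeGroup (Fin (n + 1)) ⧸ markedHNN a H) ≃*
        (FreeGroup (Fin (n + 1)) ⧸
          markedHNN a (Subgroup.map (MulAut.conj g).toMonoidHom H))) := by
  refine ⟨markedHNN_injective a hgen, markedHNN_continuous a, fun H => inferInstance, ?_⟩
  intro H g
  obtain ⟨e⟩ := HNN_conj H _ g rfl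
  have e1 : ∀ K : Subgroup G, Nonempty ((FreeGroup (Fin (n + 1)) ⧸ markedHNN a K) ≃*
      HNNExtension G K K (MulEquiv.refl K)) := fun K =>
    ⟨QuotientGroup.quotientKerEquivOfSurjective (markHom a K) (markHom_surjective a hgen K)⟩
  obtain ⟨e1H⟩ := e1 H
  obtain ⟨e1K⟩ := e1 (Subgroup.map (MulAut.conj g).toMonoidHom H)
  exact ⟨e1H.trans (e.trans e1K.symm)⟩
end
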